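/- Let γ > γ₀ > 1, c > 0 and y₀ > 0. There is no twice continuously differentiable function F : [y₀,∞) → ℝ such that F′(y) < 0 for all y ≥ y₀, F(y) ≤ c(1 − y^γ) for all y ≥ y₀, and F″(y)/F′(y) ≤ (γ₀−1)/y for all y ≥ y₀. (Indeed, the last condition forces F(y) ≥ F(y₀) + (y₀F′(y₀)/γ₀)((y/y₀)^{γ₀} − 1), so F(y)/y^{γ₀} stays bounded below, contradicting F(y)/y^{γ₀} → −∞.) -/

import Mathlib

open Real Set

/-- A function with nonnegative derivative on `[a,∞)` is monotone there. -/
theorem monotoneOn_Ici_of_hasDerivWithinAt_nonneg {a : ℝ} {f f' : ℝ → ℝ}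
    (hf : ∀ y ∈ Set.Ici a, HasDerivWithinAt f (f' y) (Set.Ici a) y)
    (hf' : ∀ y ∈ Set.Ici a, 0 ≤ f' y) : MonotoneOn f (Set.Ici a) :=
  monotoneOn_of_hasDerivWithinAt_nonneg (convex_Ici a)
    (fun y hy => (hf y hy).continuousWithinAt)
    (fun y hy => (hf y (interior_subset hy)).mono interior_subset)
    (fun y hy => hf' y (interior_subset hy))

/-- If `F' < 0` and `F''/F' ≤ p/y` on `[a,∞)`, then `F' y * y ^ (-p)` is monotone there. -/
theorem monotoneOn_mul_rpow_neg_of_div_le {a p : ℝ} (ha : 0 < a) {F' F'' : ℝ → ℝ}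
    (hd : ∀ y ∈ Set.Ici a, HasDerivWithinAt F' (F'' y) (Set.Ici a) y)
    (hneg : ∀ y ∈ Set.Ici a, F' y < 0)
    (hcurv : ∀ y ∈ Set.Ici a, F'' y / F' y ≤ p / y) :
    MonotoneOn (fun y => F' y * y ^ (-p)) (Set.Ici a) := by
  refine monotoneOn_Ici_of_hasDerivWithinAt_nonneg
    (fun y hy => (hd y hy).mul
      (Real.hasDerivAt_rpow_const (Or.inl (ha.trans_le hy).ne')).hasDerivWithinAt)
    fun y hy => ?_
  have hy0 : 0 < y := ha.trans_le hy
  have hF : p / y * F' y ≤ F'' y := (div_le_iff_of_neg (hneg y hy)).1 (hcurv y hy)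
  have key : F'' y * y ^ (-p) + F' y * (-p * y ^ (-p - 1))
      = (F'' y - p / y * F' y) * y ^ (-p) := by
    rw [Real.rpow_sub_one hy0.ne']
    ring
  rw [key]
  exact mul_nonneg (sub_nonneg.2 hF) (Real.rpow_nonneg hy0.le _)

/-- A power `y ^ γ` eventually beats any affine function of `y ^ γ₀` with `0 ≤ γ₀ < γ`. -/
theorem exists_ge_add_mul_rpow_lt_mul_rpow {γ γ₀ c : ℝ} (hγ : γ₀ < γ) (hγ₀ : 0 ≤ γ₀)
    (hc : 0 < c) (a A B : ℝ) : ∃ y ≥ a, A + B * y ^ γ₀ < c * y ^ γ := by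
  obtain ⟨y, hy, hya, hy1⟩ :=
    (((tendsto_rpow_atTop (sub_pos.2 hγ)).eventually_gt_atTop ((|A| + B) / c)).and
      ((Filter.eventually_ge_atTop a).and (Filter.eventually_ge_atTop 1))).exists
  refine ⟨y, hya, ?_⟩
  have hone : 1 ≤ y ^ γ₀ := Real.one_le_rpow hy1 hγ₀
  have hsplit : y ^ γ = y ^ (γ - γ₀) * y ^ γ₀ := by
    rw [← Real.rpow_add (by linarith), sub_add_cancel]
  calc A + B * y ^ γ₀ ≤ (|A| + B) * y ^ γ₀ := by
        nlinarith [le_abs_self A, mul_le_mul_of_nonneg_left hone (abs_nonneg A)]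
    _ < y ^ (γ - γ₀) * c * y ^ γ₀ :=
        mul_lt_mul_of_pos_right ((div_lt_iff₀ hc).1 hy) (by linarith)
    _ = c * y ^ γ := by rw [hsplit]; ring

/-- There is no `C²` function `F` on `[y₀,∞)` (with `y₀ > 0`) such that `F' < 0`,
`F(y) ≤ c(1 - y^γ)` and `F''(y)/F'(y) ≤ (γ₀-1)/y` on `[y₀,∞)`, when
`1 < γ₀ < γ` and `c > 0`. -/
theorem no_small_curvature_with_fast_decay
    (γ γ₀ c y₀ : ℝ) (hγ : γ₀ < γ) (hγ₀ : 1 < γ₀) (hc : 0 < c) (hy₀ : 0 < y₀)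
    (F F' F'' : ℝ → ℝ)
    (hd1 : ∀ y ∈ Set.Ici y₀, HasDerivWithinAt F (F' y) (Set.Ici y₀) y)
    (hd2 : ∀ y ∈ Set.Ici y₀, HasDerivWithinAt F' (F'' y) (Set.Ici y₀) y)
    (hd2c : ContinuousOn F'' (Set.Ici y₀))
    (hneg : ∀ y ∈ Set.Ici y₀, F' y < 0)
    (hgrowth : ∀ y ∈ Set.Ici y₀, F y ≤ c * (1 - y ^ γ))
    (hcurv : ∀ y ∈ Set.Ici y₀, F'' y / F' y ≤ (γ₀ - 1) / y) :
    False := by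
  set K := F' y₀ * y₀ ^ (-(γ₀ - 1))
  have hγ₀pos : 0 < γ₀ := by linarith
  have hF' : ∀ y ∈ Set.Ici y₀, K * y ^ (γ₀ - 1) ≤ F' y := fun y hy => by
    have hpos : 0 < y := hy₀.trans_le hy
    have h : K ≤ F' y * y ^ (-(γ₀ - 1)) :=
      monotoneOn_mul_rpow_neg_of_div_le hy₀ hd2 hneg hcurv Set.self_mem_Ici hy hy
    rwa [Real.rpow_neg hpos.le, ← div_eq_mul_inv, le_div_iff₀ (by positivity)] at h
  have hmono : MonotoneOn (fun y => F y - K / γ₀ * y ^ γ₀) (Set.Ici y₀) := by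
    refine monotoneOn_Ici_of_hasDerivWithinAt_nonneg
      (fun y hy => (hd1 y hy).sub
        ((Real.hasDerivAt_rpow_const
          (Or.inl (hy₀.trans_le hy).ne')).hasDerivWithinAt.const_mul (K / γ₀)))
      fun y hy => ?_
    rw [← mul_assoc, div_mul_cancel₀ _ hγ₀pos.ne']
    exact sub_nonneg.2 (hF' y hy)
  obtain ⟨y, hy, hlt⟩ := exists_ge_add_mul_rpow_lt_mul_rpow hγ hγ₀pos.le hc y₀
    (c - (F y₀ - K / γ₀ * y₀ ^ γ₀)) (-(K / γ₀))
  have hge : F y₀ - K / γ₀ * y₀ ^ γ₀ ≤ F y - K / γ₀ * y ^ γ₀ := hmono Set.self_mem_Ici hy hy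
  linarith [hgrowth y hy]
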